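/- Let u : ℝ × ℝ → ℝ be such that for each t the function u(t,·) is C³, set m := u - ∂_x²u, and assume the evolution equation ∂_t m = -(u+Γ)∂_x m - 2(∂_x u) m - λ m + ∂_x(h∘u) holds for all (t,x), with enough regularity that ∂_t m and ∂_t ∂_x m exist and ∂_t ∂_x m = ∂_x ∂_t m. Assume for each t that u, ∂_x u, m, ∂_x m all tend to 0 as x → ±∞, that all integrands below are integrable in x, and that t ↦ ∫_ℝ (m² + (∂_x m)²) dx is differentiable with derivative ∫_ℝ ∂_t(m² + (∂_x m)²) dx. Then for every t: d/dt ∫_ℝ (m² + (∂_x m)²) dx = -∫_ℝ (∂_x u) m² dx - 5∫_ℝ (∂_x u)(∂_x m)² dx - 2λ ∫_ℝ (m² + (∂_x m)²) dx + 2( ∫_ℝ m ∂_x(h∘u) dx + ∫_ℝ (∂_x m) ∂_x²(h∘u) dx ). -/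

import Mathlib

open MeasureTheory Filter

/-- The nonlinearity `h(z) = (α+Γ)z + (β/3)z³ + (γ/4)z⁴` of the dissipative
Camassa–Holm-type equation in nonlocal form. -/
noncomputable def hfun (α β γ Γ : ℝ) : ℝ → ℝ := fun z =>
  (α + Γ) * z + (β / 3) * z ^ 3 + (γ / 4) * z ^ 4

/-- The momentum variable `m = u - ∂_x²u` of a curried `u : ℝ → ℝ → ℝ`. -/
noncomputable def mfun (u : ℝ → ℝ → ℝ) : ℝ → ℝ → ℝ := fun t x =>
  u t x - deriv (deriv (u t)) x

/-- Dominated convergence with a varying dominating function whose integrals converge. -/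
lemma tendsto_integral_of_varying_dominated {ι : Type*} {l : Filter ι} [l.IsCountablyGenerated]
    {F G : ι → ℝ → ℝ} {f g : ℝ → ℝ}
    (hFm : ∀ᶠ i in l, AEStronglyMeasurable (F i)) (hG : ∀ᶠ i in l, Integrable (G i))
    (hg : Integrable g) (hb : ∀ᶠ i in l, ∀ x, |F i x| ≤ G i x)
    (hF : ∀ x, Tendsto (fun i => F i x) l (nhds (f x)))
    (hGlim : ∀ x, Tendsto (fun i => G i x) l (nhds (g x)))
    (hGint : Tendsto (fun i => ∫ x, G i x) l (nhds (∫ x, g x))) :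
    Tendsto (fun i => ∫ x, F i x) l (nhds (∫ x, f x)) := by
  rcases l.eq_or_neBot with rfl | hne
  · exact tendsto_bot
  have hfg : ∀ x, |f x| ≤ g x := fun x =>
    le_of_tendsto_of_tendsto (hF x).abs (hGlim x) (hb.mono fun i hi => hi x)
  have hg0 : ∀ x, 0 ≤ g x := fun x => (abs_nonneg _).trans (hfg x)
  have hp : Tendsto (fun i => ∫ x, max (g x - G i x) 0) l (nhds 0) := by
    have := tendsto_integral_filter_of_dominated_convergence (μ := volume)
      (F := fun i x => max (g x - G i x) 0) (f := fun _ => (0 : ℝ)) (l := l) g ?_ ?_ hg ?_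
    · simpa using this
    · filter_upwards [hG] with i hi
      exact ((hg.sub hi).sup (integrable_zero ℝ ℝ volume)).aestronglyMeasurable
    · filter_upwards [hb] with i hi
      refine Eventually.of_forall fun x => ?_
      have h1 := (abs_nonneg _).trans (hi x)
      rw [Real.norm_eq_abs, abs_of_nonneg (le_max_right _ _)]
      exact max_le (by linarith) (hg0 x)
    · refine Eventually.of_forall fun x => ?_
      simpa using ((hGlim x).const_sub (g x)).max (tendsto_const_nhds (x := (0 : ℝ)))
  have hq : Tendsto (fun i => ∫ x, (G i x - g x + max (g x - G i x) 0)) l (nhds 0) := by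
    have h1 : Tendsto (fun i => ((∫ x, G i x) - ∫ x, g x) + ∫ x, max (g x - G i x) 0) l
        (nhds 0) := by
      simpa using (hGint.sub_const (∫ x, g x)).add hp
    refine h1.congr' ?_
    filter_upwards [hG] with i hi
    have i1 : Integrable fun x => G i x - g x := hi.sub hg
    have i2 : Integrable fun x => max (g x - G i x) 0 :=
      (hg.sub hi).sup (integrable_zero ℝ ℝ volume)
    rw [integral_add i1 i2, integral_sub hi hg]
  have hcm : ∀ᶠ i in l, AEStronglyMeasurable (fun x => max (-g x) (min (F i x) (g x))) := by
    filter_upwards [hFm] with i hi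
    exact hg.aestronglyMeasurable.neg.sup (hi.inf hg.aestronglyMeasurable)
  have hcb : ∀ i x, |max (-g x) (min (F i x) (g x))| ≤ g x := fun i x => by
    have := hg0 x
    exact abs_le.2 ⟨le_max_left _ _, max_le (by linarith) (min_le_right _ _)⟩
  have hc : Tendsto (fun i => ∫ x, max (-g x) (min (F i x) (g x))) l (nhds (∫ x, f x)) := by
    refine tendsto_integral_filter_of_dominated_convergence g hcm
      (Eventually.of_forall fun i => Eventually.of_forall fun x => hcb i x) hg
      (Eventually.of_forall fun x => ?_)
    have h1 := (tendsto_const_nhds (x := -g x)).max ((hF x).min (tendsto_const_nhds (x := g x)))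
    have h2 := abs_le.1 (hfg x)
    rwa [min_eq_left h2.2, max_eq_right h2.1] at h1
  have hd : Tendsto (fun i => ∫ x, (F i x - max (-g x) (min (F i x) (g x)))) l (nhds 0) := by
    refine squeeze_zero_norm' ?_ hq
    filter_upwards [hG, hb] with i hi hbi
    refine norm_integral_le_of_norm_le
      ((hi.sub hg).add ((hg.sub hi).sup (integrable_zero ℝ ℝ volume)))
      (Eventually.of_forall fun x => ?_)
    have h2 := abs_le.1 (hbi x)
    have h3 := hg0 x
    rw [Real.norm_eq_abs, abs_le]
    have h4 := le_max_left (g x - G i x) 0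
    have h5 := le_max_right (g x - G i x) 0
    constructor
    · rcases max_cases (-g x) (min (F i x) (g x)) with h | h <;>
      rcases min_cases (F i x) (g x) with h' | h' <;> linarith
    · rcases max_cases (-g x) (min (F i x) (g x)) with h | h <;>
      rcases min_cases (F i x) (g x) with h' | h' <;> linarith
  have := hc.add hd
  rw [add_zero] at this
  refine this.congr' ?_
  filter_upwards [hFm, hcm, hG, hb] with i h1 h2 h3 h4
  have i1 : Integrable (fun x => max (-g x) (min (F i x) (g x))) :=
    hg.mono' h2 (Eventually.of_forall (hcb i))
  have i2 : Integrable (F i) := h3.mono' h1 (Eventually.of_forall h4)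
  rw [integral_sub i2 i1]
  ring

/-- Fubini for a separately continuous function on a strip with uniformly bounded slices. -/
lemma integral_intervalIntegral_swap_of_bound {a b : ℝ} (hab : a ≤ b) {F : ℝ → ℝ → ℝ}
    (hτ : ∀ x, Continuous fun τ => F τ x) (hx : ∀ τ, Continuous (F τ))
    (hint : ∀ τ ∈ Set.Icc a b, Integrable (F τ)) {C : ℝ}
    (hC : ∀ τ ∈ Set.Icc a b, ∫ x, |F τ x| ≤ C) :
    Integrable (fun x => ∫ τ in a..b, F τ x) ∧
    IntervalIntegrable (fun τ => ∫ x, F τ x) volume a b ∧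
    ∫ x, ∫ τ in a..b, F τ x = ∫ τ in a..b, ∫ x, F τ x := by
  have hm : StronglyMeasurable (Function.uncurry F) :=
    stronglyMeasurable_uncurry_of_continuous_of_stronglyMeasurable hτ
      fun τ => (hx τ).stronglyMeasurable
  have hI : Integrable (Function.uncurry F) ((volume.restrict (Set.Ioc a b)).prod volume) := by
    rw [integrable_prod_iff hm.aestronglyMeasurable]
    have hmem : ∀ᵐ τ ∂(volume.restrict (Set.Ioc a b)), τ ∈ Set.Ioc a b :=
      ae_restrict_mem measurableSet_Ioc
    refine ⟨?_, ?_⟩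
    · filter_upwards [hmem] with τ h
      exact hint τ (Set.Ioc_subset_Icc_self h)
    · refine (integrable_const C).mono'
        hm.norm.aestronglyMeasurable.integral_prod_right' ?_
      filter_upwards [hmem] with τ h
      rw [Real.norm_of_nonneg (integral_nonneg fun _ => norm_nonneg _)]
      exact hC τ (Set.Ioc_subset_Icc_self h)
  simp only [intervalIntegral.integral_of_le hab, intervalIntegrable_iff_integrableOn_Ioc_of_le hab]
  exact ⟨hI.integral_prod_right, hI.integral_prod_left, (integral_integral_swap hI).symm⟩

/-- A square-integrable `C¹` function with square-integrable derivative that vanishes at `-∞`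
is bounded by its Sobolev norm. -/
lemma sq_le_integral_sq_add_sq {f f' : ℝ → ℝ} (hf : ∀ x, HasDerivAt f (f' x) x)
    (hf' : Continuous f') (hbot : Tendsto f atBot (nhds 0)) {g : ℝ → ℝ} (hg : Integrable g)
    (hle : ∀ x, f x ^ 2 + f' x ^ 2 ≤ g x) (x : ℝ) : f x ^ 2 ≤ ∫ y, g y := by
  have hc : Continuous f := continuous_iff_continuousAt.2 fun x => (hf x).continuousAt
  have hI : Integrable (fun y => 2 * f y * f' y) := by
    refine hg.mono' (by fun_prop) (Eventually.of_forall fun y => ?_)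
    rw [Real.norm_eq_abs, abs_le]
    constructor <;> nlinarith [hle y, sq_nonneg (f y - f' y), sq_nonneg (f y + f' y)]
  have h1 : ∫ y in Set.Iic x, 2 * f y * f' y = f x ^ 2 - 0 := by
    refine integral_Iic_of_hasDerivAt_of_tendsto' (f := fun y => f y ^ 2)
      (fun y _ => ?_) hI.integrableOn ?_
    · simpa using (hf y).fun_pow 2
    · simpa using hbot.pow 2
  rw [sub_zero] at h1
  rw [← h1]
  refine (setIntegral_mono hI.integrableOn hg.integrableOn fun y => ?_).trans
    (setIntegral_le_integral hg (Eventually.of_forall fun y => ?_))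
  · simp only []
    nlinarith [hle y, sq_nonneg (f y - f' y)]
  · exact (by positivity : (0 : ℝ) ≤ f y ^ 2 + f' y ^ 2).trans (hle y)

/-- The `H²` norm of a decaying function is controlled by the `L²` norm of `f - f_xx`. -/
lemma integral_sq_sub_second_deriv {f f' m : ℝ → ℝ} (hf : ∀ x, HasDerivAt f (f' x) x)
    (hf' : ∀ x, HasDerivAt f' (f x - m x) x) (hm : Continuous m)
    (hm2 : Integrable fun x => m x ^ 2)
    (hbot : Tendsto f atBot (nhds 0)) (htop : Tendsto f atTop (nhds 0))
    (hbot' : Tendsto f' atBot (nhds 0)) (htop' : Tendsto f' atTop (nhds 0)) :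
    Integrable (fun x => f x ^ 2 + 2 * f' x ^ 2 + (f x - m x) ^ 2) ∧
    ∫ x, (f x ^ 2 + 2 * f' x ^ 2 + (f x - m x) ^ 2) = ∫ x, m x ^ 2 := by
  have hc : Continuous f := continuous_iff_continuousAt.2 fun x => (hf x).continuousAt
  have hc' : Continuous f' := continuous_iff_continuousAt.2 fun x => (hf' x).continuousAt
  have hd : ∀ x, HasDerivAt (fun y => 2 * (f y * f' y))
      (f x ^ 2 + 2 * f' x ^ 2 + (f x - m x) ^ 2 - m x ^ 2) x := fun x => by
    exact (((hf x).fun_mul (hf' x)).const_mul 2).congr_deriv (by ring)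
  have hB : Tendsto (fun y => 2 * (f y * f' y)) atBot (nhds 0) := by
    simpa using (hbot.mul hbot').const_mul 2
  have hT : Tendsto (fun y => 2 * (f y * f' y)) atTop (nhds 0) := by
    simpa using (htop.mul htop').const_mul 2
  have hI : Integrable (fun x => f x ^ 2 + 2 * f' x ^ 2 + (f x - m x) ^ 2) := by
    refine integrable_of_intervalIntegral_norm_bounded (l := atTop) (a := fun R : ℝ => -R)
      (b := fun R => R) ((∫ x, m x ^ 2) + 1) (fun R => ?_) tendsto_neg_atTop_atBot tendsto_id ?_
    · exact (Continuous.integrableOn_Icc (by fun_prop)).mono_set Set.Ioc_subset_Icc_self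
    · have h0 : Tendsto (fun R : ℝ => 2 * (f R * f' R) - 2 * (f (-R) * f' (-R))) atTop
          (nhds 0) := by
        simpa using hT.sub (hB.comp tendsto_neg_atTop_atBot)
      filter_upwards [h0.eventually (gt_mem_nhds one_pos), eventually_ge_atTop 0] with R hR hR0
      have h1 : ∫ x in (-R)..R, (f x ^ 2 + 2 * f' x ^ 2 + (f x - m x) ^ 2 - m x ^ 2)
          = 2 * (f R * f' R) - 2 * (f (-R) * f' (-R)) :=
        intervalIntegral.integral_eq_sub_of_hasDerivAt (fun x _ => hd x)
          (Continuous.intervalIntegrable (by fun_prop) _ _)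
      rw [intervalIntegral.integral_sub (Continuous.intervalIntegrable (by fun_prop) _ _)
        (Continuous.intervalIntegrable (by fun_prop) _ _)] at h1
      have h2 : ∫ x in (-R)..R, m x ^ 2 ≤ ∫ x, m x ^ 2 := by
        rw [intervalIntegral.integral_of_le (by linarith)]
        exact setIntegral_le_integral hm2 (Eventually.of_forall fun y => sq_nonneg _)
      have h3 : ∀ x, ‖f x ^ 2 + 2 * f' x ^ 2 + (f x - m x) ^ 2‖
          = f x ^ 2 + 2 * f' x ^ 2 + (f x - m x) ^ 2 := fun x =>
        Real.norm_of_nonneg (by positivity)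
      simp only [h3]
      linarith
  refine ⟨hI, ?_⟩
  have := integral_of_hasDerivAt_of_tendsto hd (hI.sub hm2) hB hT
  rw [integral_sub hI hm2] at this
  linarith

/-- Averages over `[x, x + δ]`, rescaled to the unit interval. -/
noncomputable def unitAverage (K : ℝ → ℝ) (δ x : ℝ) : ℝ := ∫ θ in (0 : ℝ)..1, K (x + θ * δ)

lemma integral_unitAverage {K : ℝ → ℝ} (hK : Continuous K) (hi : Integrable K) (δ : ℝ) :
    Integrable (unitAverage K δ) ∧ ∫ x, unitAverage K δ x = ∫ x, K x := by
  have h := integral_intervalIntegral_swap_of_bound (zero_le_one' ℝ)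
    (F := fun θ x => K (x + θ * δ)) (C := ∫ x, |K x|) (fun x => by fun_prop)
    (fun τ => by fun_prop) (fun τ _ => hi.comp_add_right _)
    (fun τ _ => (integral_add_right_eq_self (fun x => |K x|) (τ * δ)).le)
  refine ⟨h.1, h.2.2.trans ?_⟩
  simp [integral_add_right_eq_self K]

lemma tendsto_unitAverage {K : ℝ → ℝ} (hK : Continuous K) (x : ℝ) :
    Tendsto (fun δ => unitAverage K δ x) (nhdsWithin 0 (Set.Ioi 0)) (nhds (K x)) := by
  have h : Continuous fun δ => unitAverage K δ x :=
    intervalIntegral.continuous_parametric_intervalIntegral_of_continuous'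
      (f := fun δ θ => K (x + θ * δ)) (by fun_prop) 0 1
  have h1 := (h.tendsto 0).mono_left (nhdsWithin_le_nhds (s := Set.Ioi 0))
  simpa [unitAverage] using h1

/-- Squares of difference quotients are dominated by averages of the squared derivative. -/
lemma sq_slope_le_unitAverage {f f' K : ℝ → ℝ} (hf : ∀ x, HasDerivAt f (f' x) x)
    (hf' : Continuous f') (hK : Continuous K) {C : ℝ} (hle : ∀ x, f' x ^ 2 ≤ C * K x) {δ : ℝ}
    (hδ : δ ≠ 0) (x : ℝ) : ((f (x + δ) - f x) / δ) ^ 2 ≤ C * unitAverage K δ x := by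
  set c := (f (x + δ) - f x) / δ with hc
  have h1 : ∫ θ in (0 : ℝ)..1, f' (x + θ * δ) = c := by
    have := intervalIntegral.integral_eq_sub_of_hasDerivAt (a := 0) (b := 1)
      (f := fun θ => f (x + θ * δ) / δ) (f' := fun θ => f' (x + θ * δ)) (fun θ _ => ?_)
      (Continuous.intervalIntegrable (by fun_prop) _ _)
    · rw [this, hc]
      simp [sub_div]
    · have h2 : HasDerivAt (fun θ : ℝ => x + θ * δ) δ θ := by
        simpa using ((hasDerivAt_id θ).mul_const δ).const_add x
      have h3 := ((hf (x + θ * δ)).comp θ h2).div_const δ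
      rwa [mul_div_cancel_right₀ _ hδ] at h3
  have h2 : 0 ≤ ∫ θ in (0 : ℝ)..1, (f' (x + θ * δ) - c) ^ 2 :=
    intervalIntegral.integral_nonneg zero_le_one fun _ _ => sq_nonneg _
  have h3 : ∫ θ in (0 : ℝ)..1, (f' (x + θ * δ) - c) ^ 2
      = (∫ θ in (0 : ℝ)..1, f' (x + θ * δ) ^ 2) - 2 * c * c + c ^ 2 := by
    rw [← h1]
    have e : ∀ θ, (f' (x + θ * δ) - ∫ θ in (0 : ℝ)..1, f' (x + θ * δ)) ^ 2
        = f' (x + θ * δ) ^ 2 - 2 * (∫ θ in (0 : ℝ)..1, f' (x + θ * δ)) * f' (x + θ * δ)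
          + (∫ θ in (0 : ℝ)..1, f' (x + θ * δ)) ^ 2 := fun θ => by ring
    simp only [e]
    rw [intervalIntegral.integral_add (Continuous.intervalIntegrable (by fun_prop) _ _)
      (Continuous.intervalIntegrable (by fun_prop) _ _),
      intervalIntegral.integral_sub (Continuous.intervalIntegrable (by fun_prop) _ _)
      (Continuous.intervalIntegrable (by fun_prop) _ _), intervalIntegral.integral_const_mul]
    simp
  have h4 : ∫ θ in (0 : ℝ)..1, f' (x + θ * δ) ^ 2 ≤ ∫ θ in (0 : ℝ)..1, C * K (x + θ * δ) :=
    intervalIntegral.integral_mono_on zero_le_one (Continuous.intervalIntegrable (by fun_prop) _ _)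
      (Continuous.intervalIntegrable (by fun_prop) _ _) fun θ _ => hle _
  rw [intervalIntegral.integral_const_mul] at h4
  unfold unitAverage
  nlinarith

/-- Integrated form of `d/dτ ∫ w² = 2 ∫ w ∂_τ w`. -/
lemma integral_sq_sub_integral_sq {a b : ℝ} (hab : a ≤ b) {w w' : ℝ → ℝ → ℝ}
    (hw : ∀ τ x, HasDerivAt (fun s => w s x) (w' τ x) τ) (hw't : ∀ x, Continuous fun s => w' s x)
    (hwx : ∀ τ, Continuous (w τ)) (hw'x : ∀ τ, Continuous (w' τ))
    (hwi : ∀ τ, Integrable fun x => w τ x ^ 2) (hw'i : ∀ τ, Integrable fun x => w' τ x ^ 2) {C : ℝ}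
    (hC : ∀ τ ∈ Set.Icc a b, (∫ x, w τ x ^ 2) + ∫ x, w' τ x ^ 2 ≤ C) :
    IntervalIntegrable (fun τ => ∫ x, 2 * w τ x * w' τ x) volume a b ∧
    (∫ x, w b x ^ 2) - ∫ x, w a x ^ 2 = ∫ τ in a..b, ∫ x, 2 * w τ x * w' τ x := by
  have hwt : ∀ x, Continuous fun s => w s x := fun x =>
    continuous_iff_continuousAt.2 fun τ => (hw τ x).continuousAt
  have hle : ∀ τ x, |2 * w τ x * w' τ x| ≤ w τ x ^ 2 + w' τ x ^ 2 := fun τ x => by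
    rw [abs_le]
    constructor <;> nlinarith [sq_nonneg (w τ x - w' τ x), sq_nonneg (w τ x + w' τ x)]
  have hi : ∀ τ, Integrable fun x => 2 * w τ x * w' τ x := fun τ =>
    ((hwi τ).add (hw'i τ)).mono' (by have := hwx τ; have := hw'x τ; fun_prop)
      (Eventually.of_forall (hle τ))
  have h := integral_intervalIntegral_swap_of_bound hab (F := fun τ x => 2 * w τ x * w' τ x)
    (C := C) (fun x => by have := hwt x; have := hw't x; fun_prop)
    (fun τ => by have := hwx τ; have := hw'x τ; fun_prop) (fun τ _ => hi τ) (fun τ hτ => by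
      refine (integral_mono (hi τ).abs ((hwi τ).add (hw'i τ)) (hle τ)).trans ?_
      rw [integral_add' (hwi τ) (hw'i τ)]
      exact hC τ hτ)
  refine ⟨h.2.1, ?_⟩
  rw [← h.2.2, ← integral_sub (hwi b) (hwi a)]
  refine integral_congr_ae (Eventually.of_forall fun x => ?_)
  refine (intervalIntegral.integral_eq_sub_of_hasDerivAt (f := fun τ => w τ x ^ 2)
    (fun τ _ => ?_) (Continuous.intervalIntegrable ?_ _ _)).symm
  · simpa using (hw τ x).fun_pow 2
  · have := hwt x; have := hw't x; fun_prop

/-- Parametric integrals are continuous under domination by a family with continuous integrals. -/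
lemma continuous_integral_of_varying_dominated {f K : ℝ → ℝ → ℝ}
    (hKi : ∀ t, Integrable (K t)) (hKc : Continuous fun t => ∫ x, K t x)
    (hKt : ∀ x, Continuous fun t => K t x) (hft : ∀ x, Continuous fun t => f t x)
    (hfx : ∀ t, Continuous (f t))
    (hb : ∀ a b, ∃ D, ∀ τ ∈ Set.Icc a b, ∀ x, |f τ x| ≤ D * K τ x) :
    Continuous fun t => ∫ x, f t x := by
  refine continuous_iff_continuousAt.2 fun t => ?_
  obtain ⟨D, hD⟩ := hb (t - 1) (t + 1)
  refine tendsto_integral_of_varying_dominated (G := fun s x => D * K s x)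
    (g := fun x => D * K t x)
    (Eventually.of_forall fun s => (hfx s).aestronglyMeasurable)
    (Eventually.of_forall fun s => (hKi s).const_mul D) ((hKi t).const_mul D) ?_
    (fun x => (hft x).tendsto t) (fun x => ((hKt x).tendsto t).const_mul D) ?_
  · filter_upwards [Icc_mem_nhds (show t - 1 < t by linarith) (show t < t + 1 by linarith)]
      with s hs using hD s hs
  · simp only [integral_const_mul]
    exact (hKc.tendsto t).const_mul D

/-- Multiplying the transport equation `w_τ = -V w_x + g` by `2 w` and integrating in space. -/
lemma integral_two_mul_transport {V V' w w' g : ℝ → ℝ} (hV : ∀ x, HasDerivAt V (V' x) x)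
    (hw : ∀ x, HasDerivAt w (w' x) x) {c d : ℝ}
    (hVbot : Tendsto V atBot (nhds c)) (hVtop : Tendsto V atTop (nhds d))
    (hwbot : Tendsto w atBot (nhds 0)) (hwtop : Tendsto w atTop (nhds 0))
    (h1 : Integrable fun x => 2 * w x * (-V x * w' x + g x))
    (h2 : Integrable fun x => V' x * w x ^ 2 + 2 * w x * g x) :
    ∫ x, 2 * w x * (-V x * w' x + g x) = ∫ x, (V' x * w x ^ 2 + 2 * w x * g x) := by
  have hd : ∀ x, HasDerivAt (fun y => V y * w y ^ 2)
      ((V' x * w x ^ 2 + 2 * w x * g x) - 2 * w x * (-V x * w' x + g x)) x := fun x =>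
    ((hV x).fun_mul ((hw x).fun_pow 2)).congr_deriv (by push_cast; ring)
  have := integral_of_hasDerivAt_of_tendsto hd (h2.sub h1) (by simpa using hVbot.mul (hwbot.pow 2))
    (by simpa using hVtop.mul (hwtop.pow 2))
  rw [integral_sub h2 h1] at this
  linarith

/-- A decaying solution `m = u - u_xx` of `m_t = -(u + Γ) m_x - 2 u_x m - lam m + H(u) u_x` with
continuous `H¹` energy; here `p = u_x` and `n = m_x`. -/
structure IsDecayingSolution (lam Γ : ℝ) (H H' : ℝ → ℝ) (u p m n : ℝ → ℝ → ℝ) : Prop where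
  hasDerivAt_H : ∀ z, HasDerivAt H (H' z) z
  continuous_H' : Continuous H'
  hasDerivAt_u : ∀ t x, HasDerivAt (u t) (p t x) x
  hasDerivAt_p : ∀ t x, HasDerivAt (p t) (u t x - m t x) x
  hasDerivAt_m : ∀ t x, HasDerivAt (m t) (n t x) x
  continuous_n : ∀ t, Continuous (n t)
  u_atBot : ∀ t, Tendsto (u t) atBot (nhds 0)
  u_atTop : ∀ t, Tendsto (u t) atTop (nhds 0)
  p_atBot : ∀ t, Tendsto (p t) atBot (nhds 0)
  p_atTop : ∀ t, Tendsto (p t) atTop (nhds 0)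
  m_atBot : ∀ t, Tendsto (m t) atBot (nhds 0)
  m_atTop : ∀ t, Tendsto (m t) atTop (nhds 0)
  evolution : ∀ t x, HasDerivAt (fun s => m s x)
    (-(u t x + Γ) * n t x + ((H (u t x) - 2 * m t x) * p t x - lam * m t x)) t
  continuous_n_time : ∀ x, Continuous fun s => n s x
  integrable_energy : ∀ t, Integrable fun x => m t x ^ 2 + n t x ^ 2
  continuous_energy : Continuous fun t => ∫ x, (m t x ^ 2 + n t x ^ 2)

namespace IsDecayingSolution

variable {lam Γ : ℝ} {H H' : ℝ → ℝ} {u p m n : ℝ → ℝ → ℝ}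

lemma continuous_H (S : IsDecayingSolution lam Γ H H' u p m n) : Continuous H :=
  continuous_iff_continuousAt.2 fun x => (S.hasDerivAt_H x).continuousAt

lemma continuous_u (S : IsDecayingSolution lam Γ H H' u p m n) (t : ℝ) : Continuous (u t) :=
  continuous_iff_continuousAt.2 fun x => (S.hasDerivAt_u t x).continuousAt

lemma continuous_p (S : IsDecayingSolution lam Γ H H' u p m n) (t : ℝ) : Continuous (p t) :=
  continuous_iff_continuousAt.2 fun x => (S.hasDerivAt_p t x).continuousAt

lemma continuous_m (S : IsDecayingSolution lam Γ H H' u p m n) (t : ℝ) : Continuous (m t) :=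
  continuous_iff_continuousAt.2 fun x => (S.hasDerivAt_m t x).continuousAt

lemma continuous_m_time (S : IsDecayingSolution lam Γ H H' u p m n) (x : ℝ) :
    Continuous fun s => m s x :=
  continuous_iff_continuousAt.2 fun t => (S.evolution t x).continuousAt

lemma integrable_m_sq (S : IsDecayingSolution lam Γ H H' u p m n) (t : ℝ) :
    Integrable fun x => m t x ^ 2 := by
  refine (S.integrable_energy t).mono' (by have := S.continuous_m t; fun_prop)
    (Eventually.of_forall fun x => ?_)
  rw [Real.norm_of_nonneg (sq_nonneg _)]
  nlinarith [sq_nonneg (n t x)]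

lemma integrable_n_sq (S : IsDecayingSolution lam Γ H H' u p m n) (t : ℝ) :
    Integrable fun x => n t x ^ 2 := by
  refine (S.integrable_energy t).mono' (by have := S.continuous_n t; fun_prop)
    (Eventually.of_forall fun x => ?_)
  rw [Real.norm_of_nonneg (sq_nonneg _)]
  nlinarith [sq_nonneg (m t x)]

lemma integral_m_sq_le (S : IsDecayingSolution lam Γ H H' u p m n) (t : ℝ) :
    ∫ x, m t x ^ 2 ≤ ∫ x, (m t x ^ 2 + n t x ^ 2) :=
  integral_mono (S.integrable_m_sq t) (S.integrable_energy t) fun x => by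
    have := sq_nonneg (n t x)
    simp only []
    linarith

lemma continuous_integral_m_sq (S : IsDecayingSolution lam Γ H H' u p m n) :
    Continuous fun t => ∫ x, m t x ^ 2 := by
  refine continuous_integral_of_varying_dominated S.integrable_energy S.continuous_energy
    (fun x => ?_) (fun x => ?_) (fun t => ?_) fun a b => ⟨1, fun τ _ x => ?_⟩
  · have := S.continuous_m_time x; have := S.continuous_n_time x; fun_prop
  · have := S.continuous_m_time x; fun_prop
  · have := S.continuous_m t; fun_prop
  · rw [abs_of_nonneg (sq_nonneg _)]
    nlinarith [sq_nonneg (n τ x)]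

lemma tendsto_integral_m_sub_sq (S : IsDecayingSolution lam Γ H H' u p m n) (t : ℝ) :
    Tendsto (fun s => ∫ x, (m s x - m t x) ^ 2) (nhds t) (nhds 0) := by
  have h : Continuous fun s => ∫ x, (m s x - m t x) ^ 2 := by
    refine continuous_integral_of_varying_dominated
      (K := fun s x => (m s x ^ 2 + n s x ^ 2) + (m t x ^ 2 + n t x ^ 2))
      (fun s => (S.integrable_energy s).add (S.integrable_energy t)) ?_
      (fun x => ?_) (fun x => ?_) (fun s => ?_) fun a b => ⟨2, fun τ _ x => ?_⟩
    · simp only [integral_add (S.integrable_energy _) (S.integrable_energy t)]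
      have := S.continuous_energy
      fun_prop
    · have := S.continuous_m_time x; have := S.continuous_n_time x; fun_prop
    · have := S.continuous_m_time x; fun_prop
    · have := S.continuous_m t; have := S.continuous_m s; fun_prop
    · rw [abs_of_nonneg (sq_nonneg _)]
      nlinarith [sq_nonneg (n τ x), sq_nonneg (n t x), sq_nonneg (m τ x + m t x)]
  simpa using h.tendsto t

lemma integrable_u_sobolev (S : IsDecayingSolution lam Γ H H' u p m n) (t : ℝ) :
    Integrable (fun x => u t x ^ 2 + 2 * p t x ^ 2 + (u t x - m t x) ^ 2) ∧
    ∫ x, (u t x ^ 2 + 2 * p t x ^ 2 + (u t x - m t x) ^ 2) = ∫ x, m t x ^ 2 :=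
  integral_sq_sub_second_deriv (S.hasDerivAt_u t) (S.hasDerivAt_p t) (S.continuous_m t)
    (S.integrable_m_sq t) (S.u_atBot t) (S.u_atTop t) (S.p_atBot t) (S.p_atTop t)

lemma u_sq_le (S : IsDecayingSolution lam Γ H H' u p m n) (t x : ℝ) :
    u t x ^ 2 ≤ ∫ x, (m t x ^ 2 + n t x ^ 2) := by
  refine le_trans ?_ (S.integral_m_sq_le t)
  rw [← (S.integrable_u_sobolev t).2]
  refine sq_le_integral_sq_add_sq (S.hasDerivAt_u t) (S.continuous_p t) (S.u_atBot t)
    (S.integrable_u_sobolev t).1 (fun x => ?_) x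
  nlinarith [sq_nonneg (p t x), sq_nonneg (u t x - m t x)]

lemma p_sq_le (S : IsDecayingSolution lam Γ H H' u p m n) (t x : ℝ) :
    p t x ^ 2 ≤ ∫ x, (m t x ^ 2 + n t x ^ 2) := by
  refine le_trans ?_ (S.integral_m_sq_le t)
  rw [← (S.integrable_u_sobolev t).2]
  refine sq_le_integral_sq_add_sq (S.hasDerivAt_p t)
    ((S.continuous_u t).sub (S.continuous_m t)) (S.p_atBot t)
    (S.integrable_u_sobolev t).1 (fun x => ?_) x
  nlinarith [sq_nonneg (p t x), sq_nonneg (u t x)]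

lemma m_sq_le (S : IsDecayingSolution lam Γ H H' u p m n) (t x : ℝ) :
    m t x ^ 2 ≤ ∫ x, (m t x ^ 2 + n t x ^ 2) :=
  sq_le_integral_sq_add_sq (S.hasDerivAt_m t) (S.continuous_n t) (S.m_atBot t)
    (S.integrable_energy t) (fun _ => le_rfl) x

lemma sq_time_increment_le (S : IsDecayingSolution lam Γ H H' u p m n) (s t x : ℝ) :
    (u s x - u t x) ^ 2 ≤ ∫ x, (m s x - m t x) ^ 2 ∧
    (p s x - p t x) ^ 2 ≤ ∫ x, (m s x - m t x) ^ 2 := by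
  have hu : ∀ x, HasDerivAt (fun y => u s y - u t y) (p s x - p t x) x := fun x =>
    (S.hasDerivAt_u s x).fun_sub (S.hasDerivAt_u t x)
  have hp : ∀ x, HasDerivAt (fun y => p s y - p t y)
      ((u s x - u t x) - (m s x - m t x)) x := fun x =>
    ((S.hasDerivAt_p s x).fun_sub (S.hasDerivAt_p t x)).congr_deriv (by ring)
  have hm : Continuous fun x => m s x - m t x := (S.continuous_m s).sub (S.continuous_m t)
  have hm2 : Integrable fun x => (m s x - m t x) ^ 2 := by
    refine (((S.integrable_m_sq s).add (S.integrable_m_sq t)).const_mul 2).mono' (hm.pow 2).aestronglyMeasurable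
      (Eventually.of_forall fun x => ?_)
    rw [Real.norm_of_nonneg (sq_nonneg _), Pi.add_apply]
    nlinarith [sq_nonneg (m s x + m t x)]
  have hub : Tendsto (fun y => u s y - u t y) atBot (nhds 0) := by
    simpa using (S.u_atBot s).sub (S.u_atBot t)
  have hpb : Tendsto (fun y => p s y - p t y) atBot (nhds 0) := by
    simpa using (S.p_atBot s).sub (S.p_atBot t)
  obtain ⟨hi, he⟩ := integral_sq_sub_second_deriv hu hp hm hm2 hub
    (by simpa using (S.u_atTop s).sub (S.u_atTop t)) hpb
    (by simpa using (S.p_atTop s).sub (S.p_atTop t))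
  rw [← he]
  refine ⟨sq_le_integral_sq_add_sq hu ((S.continuous_p s).sub (S.continuous_p t)) hub hi
    (fun y => ?_) x, sq_le_integral_sq_add_sq hp
    (((S.continuous_u s).sub (S.continuous_u t)).sub hm) hpb hi (fun y => ?_) x⟩
  · nlinarith [sq_nonneg (p s y - p t y), sq_nonneg ((u s y - u t y) - (m s y - m t y))]
  · nlinarith [sq_nonneg (p s y - p t y), sq_nonneg (u s y - u t y)]

lemma continuous_u_time (S : IsDecayingSolution lam Γ H H' u p m n) (x : ℝ) :
    Continuous fun s => u s x := by
  refine continuous_iff_continuousAt.2 fun t => tendsto_iff_norm_sub_tendsto_zero.2 ?_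
  have h := (S.tendsto_integral_m_sub_sq t).sqrt
  rw [Real.sqrt_zero] at h
  exact squeeze_zero (fun _ => norm_nonneg _)
    (fun s => Real.abs_le_sqrt (S.sq_time_increment_le s t x).1) h

lemma continuous_p_time (S : IsDecayingSolution lam Γ H H' u p m n) (x : ℝ) :
    Continuous fun s => p s x := by
  refine continuous_iff_continuousAt.2 fun t => tendsto_iff_norm_sub_tendsto_zero.2 ?_
  have h := (S.tendsto_integral_m_sub_sq t).sqrt
  rw [Real.sqrt_zero] at h
  exact squeeze_zero (fun _ => norm_nonneg _)
    (fun s => Real.abs_le_sqrt (S.sq_time_increment_le s t x).2) h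

end IsDecayingSolution

/-- The density of `‖m‖_{H¹}² + ‖u‖_{H²}²`, with `p = u_x`, `n = m_x` and `u_xx = u - m`. -/
def sobolevDensity (u p m n : ℝ → ℝ → ℝ) (t x : ℝ) : ℝ :=
  (m t x ^ 2 + n t x ^ 2) + (u t x ^ 2 + 2 * p t x ^ 2 + (u t x - m t x) ^ 2)

namespace IsDecayingSolution

variable {lam Γ : ℝ} {H H' : ℝ → ℝ} {u p m n : ℝ → ℝ → ℝ}

lemma integrable_density (S : IsDecayingSolution lam Γ H H' u p m n) (t : ℝ) :
    Integrable (sobolevDensity u p m n t) :=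
  (S.integrable_energy t).add (S.integrable_u_sobolev t).1

lemma integral_density (S : IsDecayingSolution lam Γ H H' u p m n) (t : ℝ) :
    ∫ x, sobolevDensity u p m n t x
      = (∫ x, (m t x ^ 2 + n t x ^ 2)) + ∫ x, m t x ^ 2 := by
  rw [← (S.integrable_u_sobolev t).2]
  exact integral_add (S.integrable_energy t) (S.integrable_u_sobolev t).1

lemma continuous_integral_density (S : IsDecayingSolution lam Γ H H' u p m n) :
    Continuous fun t => ∫ x, sobolevDensity u p m n t x := by
  simp only [S.integral_density]
  exact S.continuous_energy.add S.continuous_integral_m_sq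

lemma continuous_density (S : IsDecayingSolution lam Γ H H' u p m n) (t : ℝ) :
    Continuous (sobolevDensity u p m n t) := by
  have := S.continuous_u t
  have := S.continuous_p t
  have := S.continuous_m t
  have := S.continuous_n t
  unfold sobolevDensity
  fun_prop

lemma continuous_density_time (S : IsDecayingSolution lam Γ H H' u p m n) (x : ℝ) :
    Continuous fun t => sobolevDensity u p m n t x := by
  have := S.continuous_u_time x
  have := S.continuous_p_time x
  have := S.continuous_m_time x
  have := S.continuous_n_time x
  unfold sobolevDensity
  fun_prop

end IsDecayingSolution

/-- The lower-order forcing `H(u) u_x - 2 u_x m`. -/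
def forcing (H : ℝ → ℝ) (u p m : ℝ → ℝ → ℝ) (t x : ℝ) : ℝ := (H (u t x) - 2 * m t x) * p t x

/-- The spatial derivative of `forcing`. -/
def forcingDeriv (H H' : ℝ → ℝ) (u p m n : ℝ → ℝ → ℝ) (t x : ℝ) : ℝ :=
  (H' (u t x) * p t x - 2 * n t x) * p t x + (H (u t x) - 2 * m t x) * (u t x - m t x)

/-- The right-hand side of the evolution equation. -/
def velocity (lam Γ : ℝ) (H : ℝ → ℝ) (u p m n : ℝ → ℝ → ℝ) (t x : ℝ) : ℝ :=
  -(u t x + Γ) * n t x + (forcing H u p m t x - lam * m t x)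

namespace IsDecayingSolution

variable {lam Γ : ℝ} {H H' : ℝ → ℝ} {u p m n : ℝ → ℝ → ℝ}

lemma hasDerivAt_forcing (S : IsDecayingSolution lam Γ H H' u p m n) (t x : ℝ) :
    HasDerivAt (forcing H u p m t) (forcingDeriv H H' u p m n t x) x :=
  ((((S.hasDerivAt_H (u t x)).comp x (S.hasDerivAt_u t x)).fun_sub
    ((S.hasDerivAt_m t x).const_mul 2)).fun_mul (S.hasDerivAt_p t x)).congr_deriv (by
      simp only [forcingDeriv, Function.comp])

lemma continuous_forcing (S : IsDecayingSolution lam Γ H H' u p m n) (t : ℝ) :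
    Continuous (forcing H u p m t) :=
  continuous_iff_continuousAt.2 fun x => (S.hasDerivAt_forcing t x).continuousAt

lemma continuous_forcing_time (S : IsDecayingSolution lam Γ H H' u p m n) (x : ℝ) :
    Continuous fun t => forcing H u p m t x := by
  have := S.continuous_H
  have := S.continuous_u_time x
  have := S.continuous_p_time x
  have := S.continuous_m_time x
  unfold forcing
  fun_prop

lemma continuous_forcingDeriv (S : IsDecayingSolution lam Γ H H' u p m n) (t : ℝ) :
    Continuous (forcingDeriv H H' u p m n t) := by
  have := S.continuous_H
  have := S.continuous_H'
  have := S.continuous_u t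
  have := S.continuous_p t
  have := S.continuous_m t
  have := S.continuous_n t
  unfold forcingDeriv
  fun_prop

lemma continuous_forcingDeriv_time (S : IsDecayingSolution lam Γ H H' u p m n) (x : ℝ) :
    Continuous fun t => forcingDeriv H H' u p m n t x := by
  have := S.continuous_H
  have := S.continuous_H'
  have := S.continuous_u_time x
  have := S.continuous_p_time x
  have := S.continuous_m_time x
  have := S.continuous_n_time x
  unfold forcingDeriv
  fun_prop

lemma continuous_velocity (S : IsDecayingSolution lam Γ H H' u p m n) (t : ℝ) :
    Continuous (velocity lam Γ H u p m n t) := by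
  have := S.continuous_forcing t
  have := S.continuous_u t
  have := S.continuous_m t
  have := S.continuous_n t
  unfold velocity
  fun_prop

lemma continuous_velocity_time (S : IsDecayingSolution lam Γ H H' u p m n) (x : ℝ) :
    Continuous fun t => velocity lam Γ H u p m n t x := by
  have := S.continuous_forcing_time x
  have := S.continuous_u_time x
  have := S.continuous_m_time x
  have := S.continuous_n_time x
  unfold velocity
  fun_prop

/-- Uniform control of the coefficients and of the forcing on a compact time interval. -/
lemma exists_bound (S : IsDecayingSolution lam Γ H H' u p m n) (a b : ℝ) :
    ∃ D, 1 ≤ D ∧ |lam| ≤ D ∧ ∀ τ ∈ Set.Icc a b,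
      (∫ x, sobolevDensity u p m n τ x ≤ D) ∧ ∀ x,
      |p τ x| ≤ D ∧ forcing H u p m τ x ^ 2 ≤ D * sobolevDensity u p m n τ x ∧
      forcingDeriv H H' u p m n τ x ^ 2 ≤ D * sobolevDensity u p m n τ x ∧
      velocity lam Γ H u p m n τ x ^ 2 ≤ D * sobolevDensity u p m n τ x := by
  obtain ⟨M, hM⟩ := (isCompact_Icc (a := a) (b := b)).exists_bound_of_continuousOn
    S.continuous_energy.continuousOn
  obtain ⟨N, hN⟩ := (isCompact_Icc (a := a) (b := b)).exists_bound_of_continuousOn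
    S.continuous_integral_density.continuousOn
  set B := √M
  have hH := S.continuous_H
  have hH' := S.continuous_H'
  obtain ⟨C, hC⟩ := (isCompact_Icc.prod (isCompact_Icc.prod isCompact_Icc) :
    IsCompact (Set.Icc (-B) B ×ˢ (Set.Icc (-B) B ×ˢ Set.Icc (-B) B))).exists_bound_of_continuousOn
    (f := fun z : ℝ × ℝ × ℝ => |z.1 + Γ| + |H' z.1 * z.2.1| + |H z.1 - 2 * z.2.2| + |z.2.1|)
    (by fun_prop)
  have hCpt : ∀ τ ∈ Set.Icc a b, ∀ x, (u τ x + Γ) ^ 2 ≤ C ^ 2 ∧ (H' (u τ x) * p τ x) ^ 2 ≤ C ^ 2 ∧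
      (H (u τ x) - 2 * m τ x) ^ 2 ≤ C ^ 2 ∧ p τ x ^ 2 ≤ C ^ 2 ∧ |p τ x| ≤ C := by
    intro τ hτ x
    have hE := (le_abs_self _).trans (hM τ hτ)
    have h := hC (u τ x, p τ x, m τ x)
      ⟨abs_le.1 (Real.abs_le_sqrt ((S.u_sq_le τ x).trans hE)),
        abs_le.1 (Real.abs_le_sqrt ((S.p_sq_le τ x).trans hE)),
        abs_le.1 (Real.abs_le_sqrt ((S.m_sq_le τ x).trans hE))⟩
    rw [Real.norm_of_nonneg (by positivity)] at h
    simp only [] at h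
    have h1 := abs_nonneg (u τ x + Γ)
    have h2 := abs_nonneg (H' (u τ x) * p τ x)
    have h3 := abs_nonneg (H (u τ x) - 2 * m τ x)
    have h4 := abs_nonneg (p τ x)
    refine ⟨?_, ?_, ?_, ?_, by linarith⟩ <;>
    · refine sq_le_sq' ?_ ?_ <;> [refine (abs_le.1 ?_).1; refine (abs_le.1 ?_).2] <;> linarith
  refine ⟨1 + |lam| + |N| + |C| + 16 * C ^ 2 + 3 * lam ^ 2, ?_, ?_, fun τ hτ => ⟨?_, fun x => ?_⟩⟩
  · have := sq_nonneg lam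
    have := sq_nonneg C
    linarith [abs_nonneg lam, abs_nonneg N, abs_nonneg C]
  · have := sq_nonneg lam
    have := sq_nonneg C
    linarith [abs_nonneg lam, abs_nonneg N, abs_nonneg C]
  · have := sq_nonneg lam
    have := sq_nonneg C
    linarith [abs_nonneg lam, abs_nonneg N, abs_nonneg C, le_abs_self N,
      le_abs_self (∫ x, sobolevDensity u p m n τ x), hN τ hτ,
      Real.norm_eq_abs (∫ x, sobolevDensity u p m n τ x)]
  · obtain ⟨h1, h2, h3, h4, h5⟩ := hCpt τ hτ x
    have hl := sq_nonneg lam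
    have hC2 := sq_nonneg C
    have key : ∀ y : ℝ, y ≤ (12 * C ^ 2 + 3 * lam ^ 2) * sobolevDensity u p m n τ x →
        y ≤ (1 + |lam| + |N| + |C| + 16 * C ^ 2 + 3 * lam ^ 2) * sobolevDensity u p m n τ x :=
      fun y hy => hy.trans (mul_le_mul_of_nonneg_right
        (by linarith [abs_nonneg lam, abs_nonneg N, abs_nonneg C])
        (by unfold sobolevDensity; positivity))
    have e1 := sq_nonneg (m τ x)
    have e2 := sq_nonneg (n τ x)
    have e3 := sq_nonneg (u τ x)
    have e4 := sq_nonneg (p τ x)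
    have e5 := sq_nonneg (u τ x - m τ x)
    have three : ∀ y z w : ℝ, (y + z + w) ^ 2 ≤ 3 * (y ^ 2 + z ^ 2 + w ^ 2) := fun y z w => by
      nlinarith [sq_nonneg (y - z), sq_nonneg (y - w), sq_nonneg (z - w)]
    refine ⟨by linarith [abs_nonneg lam, abs_nonneg N, abs_nonneg C, le_abs_self C],
      key _ ?_, key _ ?_, key _ ?_⟩
    · have := mul_le_mul_of_nonneg_right h3 e4
      unfold forcing sobolevDensity
      rw [mul_pow]
      nlinarith [mul_nonneg hC2 e1, mul_nonneg hC2 e2, mul_nonneg hC2 e3, mul_nonneg hC2 e4,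
        mul_nonneg hC2 e5, mul_nonneg hl e1, mul_nonneg hl e2, mul_nonneg hl e3, mul_nonneg hl e4,
        mul_nonneg hl e5]
    · have i1 := mul_le_mul_of_nonneg_right h2 e4
      have i2 := mul_le_mul_of_nonneg_right h4 e2
      have i3 := mul_le_mul_of_nonneg_right h3 e5
      have i4 := three (H' (u τ x) * p τ x * p τ x) (-2 * n τ x * p τ x)
        ((H (u τ x) - 2 * m τ x) * (u τ x - m τ x))
      have i5 : forcingDeriv H H' u p m n τ x = H' (u τ x) * p τ x * p τ x + -2 * n τ x * p τ x
        + (H (u τ x) - 2 * m τ x) * (u τ x - m τ x) := by unfold forcingDeriv; ring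
      rw [i5]
      unfold sobolevDensity
      simp only [mul_pow] at i1 i2 i3 i4 ⊢
      nlinarith [mul_nonneg hC2 e1, mul_nonneg hC2 e2, mul_nonneg hC2 e3, mul_nonneg hC2 e4,
        mul_nonneg hC2 e5, mul_nonneg hl e1, mul_nonneg hl e2, mul_nonneg hl e3, mul_nonneg hl e4,
        mul_nonneg hl e5]
    · have i1 := mul_le_mul_of_nonneg_right h1 e2
      have i2 := mul_le_mul_of_nonneg_right h3 e4
      have i4 := three (-(u τ x + Γ) * n τ x) ((H (u τ x) - 2 * m τ x) * p τ x) (-lam * m τ x)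
      have i5 : velocity lam Γ H u p m n τ x = -(u τ x + Γ) * n τ x
        + (H (u τ x) - 2 * m τ x) * p τ x + -lam * m τ x := by unfold velocity forcing; ring
      rw [i5]
      unfold sobolevDensity
      simp only [mul_pow, neg_sq] at i1 i2 i4 ⊢
      nlinarith [mul_nonneg hC2 e1, mul_nonneg hC2 e2, mul_nonneg hC2 e3, mul_nonneg hC2 e4,
        mul_nonneg hC2 e5, mul_nonneg hl e1, mul_nonneg hl e2, mul_nonneg hl e3, mul_nonneg hl e4,
        mul_nonneg hl e5]

end IsDecayingSolution

/-- The difference quotient of `f` with step `δ`. -/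
noncomputable def diffQuotient (f : ℝ → ℝ) (δ x : ℝ) : ℝ := (f (x + δ) - f x) / δ

lemma hasDerivAt_diffQuotient {f f' : ℝ → ℝ} (hf : ∀ x, HasDerivAt f (f' x) x) (δ x : ℝ) :
    HasDerivAt (diffQuotient f δ) (diffQuotient f' δ x) x :=
  (((hf (x + δ)).comp_add_const x δ).fun_sub (hf x)).div_const δ

lemma continuous_diffQuotient {f : ℝ → ℝ} (hf : Continuous f) (δ : ℝ) :
    Continuous (diffQuotient f δ) := by
  unfold diffQuotient
  fun_prop

lemma tendsto_diffQuotient_zero {f : ℝ → ℝ} {l : Filter ℝ} {δ : ℝ}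
    (hl : Tendsto (fun x => x + δ) l l) (hf : Tendsto f l (nhds 0)) :
    Tendsto (diffQuotient f δ) l (nhds 0) := by
  have h := ((hf.comp hl).sub hf).div_const δ
  rw [sub_zero, zero_div] at h
  exact h

lemma tendsto_diffQuotient {f : ℝ → ℝ} {f' x : ℝ} (hf : HasDerivAt f f' x) :
    Tendsto (fun δ => diffQuotient f δ x) (nhdsWithin 0 (Set.Ioi 0)) (nhds f') := by
  have h := hf.tendsto_slope_zero.mono_left
    (nhdsWithin_mono 0 fun y (hy : 0 < y) => Set.mem_compl_singleton_iff.2 hy.ne')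
  refine h.congr fun δ => ?_
  rw [diffQuotient, smul_eq_mul, div_eq_inv_mul]

lemma integral_diffQuotient_sq_le {f : ℝ → ℝ} (hf : Continuous f)
    (hi : Integrable fun x => f x ^ 2) (δ : ℝ) :
    Integrable (fun x => diffQuotient f δ x ^ 2) ∧
    ∫ x, diffQuotient f δ x ^ 2 ≤ 4 / δ ^ 2 * ∫ x, f x ^ 2 := by
  have h1 : Integrable fun x => f (x + δ) ^ 2 := hi.comp_add_right δ
  have hle : ∀ x, diffQuotient f δ x ^ 2 ≤ 2 / δ ^ 2 * (f (x + δ) ^ 2 + f x ^ 2) := fun x => by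
    rw [diffQuotient, div_pow, div_mul_eq_mul_div]
    gcongr
    nlinarith [sq_nonneg (f (x + δ) + f x)]
  have hI : Integrable fun x => diffQuotient f δ x ^ 2 :=
    ((h1.add hi).const_mul (2 / δ ^ 2)).mono'
      ((continuous_diffQuotient hf δ).pow 2).aestronglyMeasurable
      (Eventually.of_forall fun x => by
        rw [Real.norm_of_nonneg (sq_nonneg _)]
        exact hle x)
  refine ⟨hI, (integral_mono hI ((h1.add hi).const_mul (2 / δ ^ 2)) hle).trans_eq ?_⟩
  rw [integral_const_mul, integral_add' h1 hi, integral_add_right_eq_self (fun x => f x ^ 2)]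
  ring

/-- The density of `d/dt ∫ m²`. -/
def massRate (lam : ℝ) (H : ℝ → ℝ) (u p m : ℝ → ℝ → ℝ) (t x : ℝ) : ℝ :=
  p t x * m t x ^ 2 + 2 * m t x * (forcing H u p m t x - lam * m t x)

/-- The density of `d/dt ∫ (m_x)²`. -/
def gradientRate (lam : ℝ) (H H' : ℝ → ℝ) (u p m n : ℝ → ℝ → ℝ) (t x : ℝ) : ℝ :=
  -p t x * n t x ^ 2 - 2 * lam * n t x ^ 2 + 2 * n t x * forcingDeriv H H' u p m n t x

/-- The analogue of `gradientRate` for difference quotients of `m`. -/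
noncomputable def quotientRate (lam : ℝ) (H : ℝ → ℝ) (u p m n : ℝ → ℝ → ℝ) (δ t x : ℝ) : ℝ :=
  p t (x + δ) * diffQuotient (m t) δ x ^ 2 + 2 * diffQuotient (m t) δ x *
    (-diffQuotient (u t) δ x * n t x - lam * diffQuotient (m t) δ x
      + diffQuotient (forcing H u p m t) δ x)

lemma sobolevDensity_nonneg (u p m n : ℝ → ℝ → ℝ) (t x : ℝ) : 0 ≤ sobolevDensity u p m n t x := by
  unfold sobolevDensity
  positivity

lemma m_sq_le_sobolevDensity (u p m n : ℝ → ℝ → ℝ) (t x : ℝ) :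
    m t x ^ 2 ≤ sobolevDensity u p m n t x := by
  unfold sobolevDensity
  nlinarith [sq_nonneg (n t x), sq_nonneg (u t x), sq_nonneg (p t x), sq_nonneg (u t x - m t x)]

lemma n_sq_le_sobolevDensity (u p m n : ℝ → ℝ → ℝ) (t x : ℝ) :
    n t x ^ 2 ≤ sobolevDensity u p m n t x := by
  unfold sobolevDensity
  nlinarith [sq_nonneg (m t x), sq_nonneg (u t x), sq_nonneg (p t x), sq_nonneg (u t x - m t x)]

lemma abs_two_mul_le_of_sq_le {y z A B : ℝ} (hy : y ^ 2 ≤ A) (hz : z ^ 2 ≤ B) :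
    |2 * y * z| ≤ A + B := by
  rw [abs_le]
  constructor <;> nlinarith [sq_nonneg (y + z), sq_nonneg (y - z)]

lemma abs_mul_le_of_abs_le {y z A B : ℝ} (hy : |y| ≤ A) (hz0 : 0 ≤ z) (hz : z ≤ B) :
    |y * z| ≤ A * B := by
  rw [abs_mul, abs_of_nonneg hz0]
  exact mul_le_mul hy hz hz0 ((abs_nonneg _).trans hy)

namespace IsDecayingSolution

variable {lam Γ : ℝ} {H H' : ℝ → ℝ} {u p m n : ℝ → ℝ → ℝ}

lemma abs_massRate_le (S : IsDecayingSolution lam Γ H H' u p m n) (a b : ℝ) :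
    ∃ D, ∀ τ ∈ Set.Icc a b, ∀ x,
      |massRate lam H u p m τ x| ≤ D * sobolevDensity u p m n τ x := by
  obtain ⟨D, hD1, hl, hD⟩ := S.exists_bound a b
  refine ⟨D + (1 + D) + 2 * D, fun τ hτ x => ?_⟩
  obtain ⟨h1, h2, -, -⟩ := (hD τ hτ).2 x
  have hm := m_sq_le_sobolevDensity u p m n τ x
  have e1 := abs_mul_le_of_abs_le h1 (sq_nonneg _) hm
  have e2 := abs_two_mul_le_of_sq_le hm h2
  have e3 := abs_mul_le_of_abs_le hl (sq_nonneg _) hm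
  have e : massRate lam H u p m τ x = p τ x * m τ x ^ 2 + 2 * m τ x * forcing H u p m τ x
      - 2 * (lam * m τ x ^ 2) := by unfold massRate; ring
  rw [e]
  rw [abs_le] at *
  constructor <;> linarith

lemma abs_gradientRate_le (S : IsDecayingSolution lam Γ H H' u p m n) (a b : ℝ) :
    ∃ D, ∀ τ ∈ Set.Icc a b, ∀ x,
      |gradientRate lam H H' u p m n τ x| ≤ D * sobolevDensity u p m n τ x := by
  obtain ⟨D, hD1, hl, hD⟩ := S.exists_bound a b
  refine ⟨D + (1 + D) + 2 * D, fun τ hτ x => ?_⟩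
  obtain ⟨h1, -, h2, -⟩ := (hD τ hτ).2 x
  have hn := n_sq_le_sobolevDensity u p m n τ x
  have e1 := abs_mul_le_of_abs_le h1 (sq_nonneg _) hn
  have e2 := abs_two_mul_le_of_sq_le hn h2
  have e3 := abs_mul_le_of_abs_le hl (sq_nonneg _) hn
  have e : gradientRate lam H H' u p m n τ x = -(p τ x * n τ x ^ 2)
      + 2 * n τ x * forcingDeriv H H' u p m n τ x
      - 2 * (lam * n τ x ^ 2) := by unfold gradientRate; ring
  rw [e]
  rw [abs_le] at *
  constructor <;> linarith

lemma continuous_massRate (S : IsDecayingSolution lam Γ H H' u p m n) (t : ℝ) :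
    Continuous (massRate lam H u p m t) := by
  have := S.continuous_p t
  have := S.continuous_m t
  have := S.continuous_forcing t
  unfold massRate
  fun_prop

lemma continuous_gradientRate (S : IsDecayingSolution lam Γ H H' u p m n) (t : ℝ) :
    Continuous (gradientRate lam H H' u p m n t) := by
  have := S.continuous_p t
  have := S.continuous_n t
  have := S.continuous_forcingDeriv t
  unfold gradientRate
  fun_prop

lemma integrable_massRate (S : IsDecayingSolution lam Γ H H' u p m n) (t : ℝ) :
    Integrable (massRate lam H u p m t) := by
  obtain ⟨D, hD⟩ := S.abs_massRate_le t t
  exact ((S.integrable_density t).const_mul D).mono' (S.continuous_massRate t).aestronglyMeasurable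
    (Eventually.of_forall (hD t ⟨le_rfl, le_rfl⟩))

lemma integrable_gradientRate (S : IsDecayingSolution lam Γ H H' u p m n) (t : ℝ) :
    Integrable (gradientRate lam H H' u p m n t) := by
  obtain ⟨D, hD⟩ := S.abs_gradientRate_le t t
  exact ((S.integrable_density t).const_mul D).mono'
    (S.continuous_gradientRate t).aestronglyMeasurable
    (Eventually.of_forall (hD t ⟨le_rfl, le_rfl⟩))

lemma continuous_integral_massRate (S : IsDecayingSolution lam Γ H H' u p m n) :
    Continuous fun t => ∫ x, massRate lam H u p m t x := by
  refine continuous_integral_of_varying_dominated S.integrable_density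
    S.continuous_integral_density S.continuous_density_time (fun x => ?_) S.continuous_massRate
    S.abs_massRate_le
  have := S.continuous_p_time x
  have := S.continuous_m_time x
  have := S.continuous_forcing_time x
  unfold massRate
  fun_prop

lemma continuous_integral_gradientRate (S : IsDecayingSolution lam Γ H H' u p m n) :
    Continuous fun t => ∫ x, gradientRate lam H H' u p m n t x := by
  refine continuous_integral_of_varying_dominated S.integrable_density
    S.continuous_integral_density S.continuous_density_time (fun x => ?_) S.continuous_gradientRate
    S.abs_gradientRate_le
  have := S.continuous_p_time x
  have := S.continuous_n_time x
  have := S.continuous_forcingDeriv_time x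
  unfold gradientRate
  fun_prop

lemma integrable_velocity_sq (S : IsDecayingSolution lam Γ H H' u p m n) (t : ℝ) :
    Integrable fun x => velocity lam Γ H u p m n t x ^ 2 := by
  obtain ⟨D, -, -, hD⟩ := S.exists_bound t t
  refine ((S.integrable_density t).const_mul D).mono'
    ((S.continuous_velocity t).pow 2).aestronglyMeasurable (Eventually.of_forall fun x => ?_)
  rw [Real.norm_of_nonneg (sq_nonneg _)]
  exact ((hD t ⟨le_rfl, le_rfl⟩).2 x).2.2.2

lemma exists_integral_sq_bound (S : IsDecayingSolution lam Γ H H' u p m n) (a b : ℝ) :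
    ∃ C, ∀ τ ∈ Set.Icc a b,
      (∫ x, m τ x ^ 2) + ∫ x, velocity lam Γ H u p m n τ x ^ 2 ≤ C := by
  obtain ⟨D, hD1, -, hD⟩ := S.exists_bound a b
  refine ⟨D + D * D, fun τ hτ => ?_⟩
  have h1 : ∫ x, m τ x ^ 2 ≤ ∫ x, sobolevDensity u p m n τ x :=
    integral_mono (S.integrable_m_sq τ) (S.integrable_density τ)
      (m_sq_le_sobolevDensity u p m n τ)
  have h2 : ∫ x, velocity lam Γ H u p m n τ x ^ 2 ≤ ∫ x, D * sobolevDensity u p m n τ x :=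
    integral_mono (S.integrable_velocity_sq τ) ((S.integrable_density τ).const_mul D)
      fun x => ((hD τ hτ).2 x).2.2.2
  rw [integral_const_mul] at h2
  have h3 := (hD τ hτ).1
  nlinarith

lemma integral_m_sq_sub (S : IsDecayingSolution lam Γ H H' u p m n) {a b : ℝ} (hab : a ≤ b) :
    (∫ x, m b x ^ 2) - ∫ x, m a x ^ 2 = ∫ τ in a..b, ∫ x, massRate lam H u p m τ x := by
  obtain ⟨C, hC⟩ := S.exists_integral_sq_bound a b
  rw [(integral_sq_sub_integral_sq hab S.evolution S.continuous_velocity_time S.continuous_m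
    S.continuous_velocity S.integrable_m_sq S.integrable_velocity_sq hC).2]
  refine intervalIntegral.integral_congr fun τ _ => ?_
  refine integral_two_mul_transport (V := fun x => u τ x + Γ)
    (fun x => (S.hasDerivAt_u τ x).add_const Γ) (S.hasDerivAt_m τ)
    ((S.u_atBot τ).add_const Γ) ((S.u_atTop τ).add_const Γ) (S.m_atBot τ) (S.m_atTop τ) ?_
    (S.integrable_massRate τ)
  refine ((S.integrable_m_sq τ).add (S.integrable_velocity_sq τ)).mono' ?_
    (Eventually.of_forall fun x => abs_two_mul_le_of_sq_le le_rfl le_rfl)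
  exact ((continuous_const.mul (S.continuous_m τ)).mul
    (S.continuous_velocity τ)).aestronglyMeasurable

lemma abs_quotientRate_le (S : IsDecayingSolution lam Γ H H' u p m n) (a b : ℝ) :
    ∃ D, ∀ τ ∈ Set.Icc a b, ∀ δ, δ ≠ 0 → ∀ x, |quotientRate lam H u p m n δ τ x|
      ≤ D * (unitAverage (sobolevDensity u p m n τ) δ x + sobolevDensity u p m n τ x) := by
  obtain ⟨D, hD1, hl, hD⟩ := S.exists_bound a b
  refine ⟨6 * D, fun τ hτ δ hδ x => ?_⟩
  have hn := n_sq_le_sobolevDensity u p m n τ x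
  have hA := sq_slope_le_unitAverage (S.hasDerivAt_m τ) (S.continuous_n τ) (S.continuous_density τ)
    (C := 1) (fun x => by simpa using n_sq_le_sobolevDensity u p m n τ x) hδ x
  have hF := sq_slope_le_unitAverage (S.hasDerivAt_forcing τ) (S.continuous_forcingDeriv τ)
    (S.continuous_density τ) (fun x => ((hD τ hτ).2 x).2.2.1) hδ x
  have hU := sq_slope_le_unitAverage (S.hasDerivAt_u τ) (S.continuous_p τ)
    (continuous_const (y := (1 : ℝ))) (C := D ^ 2)
    (fun x => by simpa using sq_le_sq' (abs_le.1 ((hD τ hτ).2 x).1).1 (abs_le.1 ((hD τ hτ).2 x).1).2)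
    hδ x
  rw [one_mul] at hA
  have hU' : |diffQuotient (u τ) δ x| ≤ D := by
    refine abs_le_of_sq_le_sq ?_ (by linarith)
    simpa [unitAverage, diffQuotient] using hU
  have hA0 := (sq_nonneg _).trans hA
  have hK0 := sobolevDensity_nonneg u p m n τ x
  have e1 := abs_mul_le_of_abs_le ((hD τ hτ).2 (x + δ)).1 (sq_nonneg _) hA
  have e2 := abs_two_mul_le_of_sq_le hA hF
  have e3 := abs_mul_le_of_abs_le hl (sq_nonneg _) hA
  have e4 := mul_le_mul hU' (abs_two_mul_le_of_sq_le hA hn) (abs_nonneg _) (by linarith)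
  rw [← abs_mul] at e4
  have e : quotientRate lam H u p m n δ τ x
      = p τ (x + δ) * ((m τ (x + δ) - m τ x) / δ) ^ 2
      - diffQuotient (u τ) δ x * (2 * ((m τ (x + δ) - m τ x) / δ) * n τ x)
      - 2 * (lam * ((m τ (x + δ) - m τ x) / δ) ^ 2)
      + 2 * ((m τ (x + δ) - m τ x) / δ)
        * ((forcing H u p m τ (x + δ) - forcing H u p m τ x) / δ) := by
    unfold quotientRate
    simp only [diffQuotient]
    ring
  rw [e]
  rw [abs_le] at e1 e2 e3 e4 ⊢
  constructor <;> nlinarith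

lemma continuous_quotientRate (S : IsDecayingSolution lam Γ H H' u p m n) (δ t : ℝ) :
    Continuous (quotientRate lam H u p m n δ t) := by
  have := S.continuous_p t
  have := S.continuous_n t
  have := continuous_diffQuotient (S.continuous_u t) δ
  have := continuous_diffQuotient (S.continuous_m t) δ
  have := continuous_diffQuotient (S.continuous_forcing t) δ
  unfold quotientRate
  fun_prop

lemma integrable_quotientRate (S : IsDecayingSolution lam Γ H H' u p m n) {δ : ℝ} (hδ : δ ≠ 0)
    (t : ℝ) : Integrable (quotientRate lam H u p m n δ t) := by
  obtain ⟨D, hD⟩ := S.abs_quotientRate_le t t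
  exact (((integral_unitAverage (S.continuous_density t) (S.integrable_density t) δ).1.add
    (S.integrable_density t)).const_mul D).mono' (S.continuous_quotientRate δ t).aestronglyMeasurable
    (Eventually.of_forall (hD t ⟨le_rfl, le_rfl⟩ δ hδ))

lemma integral_diffQuotient_sq_sub (S : IsDecayingSolution lam Γ H H' u p m n) {a b : ℝ}
    (hab : a ≤ b) {δ : ℝ} (hδ : δ ≠ 0) :
    IntervalIntegrable (fun τ => ∫ x, quotientRate lam H u p m n δ τ x) volume a b ∧
    (∫ x, diffQuotient (m b) δ x ^ 2) - ∫ x, diffQuotient (m a) δ x ^ 2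
      = ∫ τ in a..b, ∫ x, quotientRate lam H u p m n δ τ x := by
  obtain ⟨C, hC⟩ := S.exists_integral_sq_bound a b
  have hm := fun τ => integral_diffQuotient_sq_le (S.continuous_m τ) (S.integrable_m_sq τ) δ
  have hv := fun τ =>
    integral_diffQuotient_sq_le (S.continuous_velocity τ) (S.integrable_velocity_sq τ) δ
  have hcm := fun τ => continuous_diffQuotient (S.continuous_m τ) δ
  have hcv := fun τ => continuous_diffQuotient (S.continuous_velocity τ) δ
  have hE := integral_sq_sub_integral_sq hab (w := fun τ => diffQuotient (m τ) δ)
    (w' := fun τ => diffQuotient (velocity lam Γ H u p m n τ) δ) (C := 4 / δ ^ 2 * C)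
    (fun τ x => ((S.evolution τ (x + δ)).fun_sub (S.evolution τ x)).div_const δ)
    (fun x => ((S.continuous_velocity_time (x + δ)).sub (S.continuous_velocity_time x)).div_const δ)
    hcm hcv (fun τ => (hm τ).1) (fun τ => (hv τ).1) (fun τ hτ => by
      refine (add_le_add (hm τ).2 (hv τ).2).trans ?_
      rw [← mul_add]
      exact mul_le_mul_of_nonneg_left (hC τ hτ) (by positivity))
  have hT : ∀ τ, ∫ x, 2 * diffQuotient (m τ) δ x * diffQuotient (velocity lam Γ H u p m n τ) δ x
      = ∫ x, quotientRate lam H u p m n δ τ x := fun τ => by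
    have hsplit : ∀ x, diffQuotient (velocity lam Γ H u p m n τ) δ x
        = -(u τ (x + δ) + Γ) * diffQuotient (n τ) δ x
          + (-diffQuotient (u τ) δ x * n τ x - lam * diffQuotient (m τ) δ x
            + diffQuotient (forcing H u p m τ) δ x) := fun x => by
      simp only [diffQuotient, velocity]
      ring
    have hI : Integrable fun x => 2 * diffQuotient (m τ) δ x
        * diffQuotient (velocity lam Γ H u p m n τ) δ x :=
      ((hm τ).1.add (hv τ).1).mono'
        ((continuous_const.mul (hcm τ)).mul (hcv τ)).aestronglyMeasurable
        (Eventually.of_forall fun x => abs_two_mul_le_of_sq_le le_rfl le_rfl)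
    simp only [hsplit] at hI ⊢
    have hB : Tendsto (fun x : ℝ => x + δ) atBot atBot := tendsto_atBot_add_const_right _ _ tendsto_id
    have hT : Tendsto (fun x : ℝ => x + δ) atTop atTop := tendsto_atTop_add_const_right _ _ tendsto_id
    exact integral_two_mul_transport (V := fun x => u τ (x + δ) + Γ)
      (fun x => ((S.hasDerivAt_u τ (x + δ)).comp_add_const x δ).add_const Γ)
      (hasDerivAt_diffQuotient (S.hasDerivAt_m τ) δ)
      (((S.u_atBot τ).comp hB).add_const Γ) (((S.u_atTop τ).comp hT).add_const Γ)
      (tendsto_diffQuotient_zero hB (S.m_atBot τ)) (tendsto_diffQuotient_zero hT (S.m_atTop τ)) hI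
      (S.integrable_quotientRate hδ τ)
  simpa only [hT] using hE

lemma tendsto_integral_of_le_unitAverage (S : IsDecayingSolution lam Γ H H' u p m n) {t : ℝ}
    {F : ℝ → ℝ → ℝ} {f : ℝ → ℝ} (hFc : ∀ δ, Continuous (F δ)) {D : ℝ}
    (hb : ∀ δ, δ ≠ 0 → ∀ x, |F δ x|
      ≤ D * (unitAverage (sobolevDensity u p m n t) δ x + sobolevDensity u p m n t x))
    (hF : ∀ x, Tendsto (fun δ => F δ x) (nhdsWithin 0 (Set.Ioi 0)) (nhds (f x))) :
    Tendsto (fun δ => ∫ x, F δ x) (nhdsWithin 0 (Set.Ioi 0)) (nhds (∫ x, f x)) := by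
  have hA := integral_unitAverage (S.continuous_density t) (S.integrable_density t)
  have hK := S.integrable_density t
  refine tendsto_integral_of_varying_dominated
    (G := fun δ x => D * (unitAverage (sobolevDensity u p m n t) δ x + sobolevDensity u p m n t x))
    (g := fun x => D * (sobolevDensity u p m n t x + sobolevDensity u p m n t x))
    (Eventually.of_forall fun δ => (hFc δ).aestronglyMeasurable)
    (Eventually.of_forall fun δ => ((hA δ).1.add hK).const_mul D) ((hK.add hK).const_mul D) ?_ hF
    (fun x => ((tendsto_unitAverage (S.continuous_density t) x).add_const _).const_mul D) ?_
  · filter_upwards [self_mem_nhdsWithin] with δ hδ using hb δ (Set.mem_Ioi.1 hδ).ne'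
  · simp only [integral_const_mul, integral_add (hA _).1 hK, (hA _).2, integral_add hK hK]
    exact tendsto_const_nhds

lemma integral_n_sq_sub (S : IsDecayingSolution lam Γ H H' u p m n) {a b : ℝ} (hab : a ≤ b) :
    (∫ x, n b x ^ 2) - ∫ x, n a x ^ 2
      = ∫ τ in a..b, ∫ x, gradientRate lam H H' u p m n τ x := by
  have hl : ∀ τ, Tendsto (fun δ => ∫ x, diffQuotient (m τ) δ x ^ 2) (nhdsWithin 0 (Set.Ioi 0))
      (nhds (∫ x, n τ x ^ 2)) := fun τ => by
    refine S.tendsto_integral_of_le_unitAverage (t := τ) (D := 1)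
      (fun δ => (continuous_diffQuotient (S.continuous_m τ) δ).pow 2) (fun δ hδ x => ?_)
      (fun x => (tendsto_diffQuotient (S.hasDerivAt_m τ x)).pow 2)
    have h := sq_slope_le_unitAverage (S.hasDerivAt_m τ) (S.continuous_n τ)
      (S.continuous_density τ) (C := 1)
      (fun x => by simpa using n_sq_le_sobolevDensity u p m n τ x) hδ x
    rw [abs_of_nonneg (sq_nonneg _)]
    rw [one_mul] at h ⊢
    exact h.trans (le_add_of_nonneg_right (sobolevDensity_nonneg u p m n τ x))
  obtain ⟨D, hD⟩ := S.abs_quotientRate_le a b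
  obtain ⟨N, -, -, hN⟩ := S.exists_bound a b
  have hr : Tendsto (fun δ => ∫ τ in a..b, ∫ x, quotientRate lam H u p m n δ τ x)
      (nhdsWithin 0 (Set.Ioi 0))
      (nhds (∫ τ in a..b, ∫ x, gradientRate lam H H' u p m n τ x)) := by
    refine intervalIntegral.tendsto_integral_filter_of_dominated_convergence
      (fun _ => |D| * (N + N)) ?_ ?_ intervalIntegrable_const ?_
    · filter_upwards [self_mem_nhdsWithin] with δ hδ
      rw [Set.uIoc_of_le hab]
      exact ((intervalIntegrable_iff_integrableOn_Ioc_of_le hab).1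
        (S.integral_diffQuotient_sq_sub hab (Set.mem_Ioi.1 hδ).ne').1).aestronglyMeasurable
    · filter_upwards [self_mem_nhdsWithin] with δ hδ
      refine Eventually.of_forall fun τ hτ => ?_
      rw [Set.uIoc_of_le hab] at hτ
      have hτ' := Set.Ioc_subset_Icc_self hτ
      have hA := integral_unitAverage (S.continuous_density τ) (S.integrable_density τ) δ
      have hK := S.integrable_density τ
      refine (norm_integral_le_of_norm_le ((hA.1.add hK).const_mul D) (Eventually.of_forall
        (hD τ hτ' δ (Set.mem_Ioi.1 hδ).ne'))).trans ?_
      rw [integral_const_mul, integral_add' hA.1 hK, hA.2]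
      have h0 : 0 ≤ ∫ x, sobolevDensity u p m n τ x :=
        integral_nonneg (sobolevDensity_nonneg u p m n τ)
      have h1 := (hN τ hτ').1
      exact mul_le_mul (le_abs_self D) (add_le_add h1 h1) (by linarith) (abs_nonneg D)
    · refine Eventually.of_forall fun τ hτ => ?_
      rw [Set.uIoc_of_le hab] at hτ
      refine S.tendsto_integral_of_le_unitAverage (S.continuous_quotientRate · τ)
        (hD τ (Set.Ioc_subset_Icc_self hτ)) fun x => ?_
      have h1 := tendsto_diffQuotient (S.hasDerivAt_m τ x)
      have h2 := tendsto_diffQuotient (S.hasDerivAt_u τ x)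
      have h3 := tendsto_diffQuotient (S.hasDerivAt_forcing τ x)
      have h4 : Tendsto (fun δ => p τ (x + δ)) (nhdsWithin 0 (Set.Ioi 0)) (nhds (p τ x)) := by
        have hc : Continuous fun δ => p τ (x + δ) := by have := S.continuous_p τ; fun_prop
        simpa using (hc.tendsto 0).mono_left (nhdsWithin_le_nhds (s := Set.Ioi 0))
      have := (h4.mul (h1.pow 2)).add ((h1.const_mul 2).mul
        (((h2.neg.mul_const (n τ x)).sub (h1.const_mul lam)).add h3))
      refine this.trans (le_of_eq (congrArg nhds ?_))
      unfold gradientRate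
      ring
  refine tendsto_nhds_unique ((hl b).sub (hl a)) (hr.congr' ?_)
  filter_upwards [self_mem_nhdsWithin] with δ hδ
  exact (S.integral_diffQuotient_sq_sub hab (Set.mem_Ioi.1 hδ).ne').2.symm

/-- The energy identity for the `H¹` norm of `m`. -/
theorem hasDerivAt_energy (S : IsDecayingSolution lam Γ H H' u p m n) (t : ℝ) :
    HasDerivAt (fun s => ∫ x, (m s x ^ 2 + n s x ^ 2))
      (∫ x, (massRate lam H u p m t x + gradientRate lam H H' u p m n t x)) t := by
  have hc : Continuous fun t => ∫ x, (massRate lam H u p m t x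
      + gradientRate lam H H' u p m n t x) := by
    simp only [integral_add (S.integrable_massRate _) (S.integrable_gradientRate _)]
    exact S.continuous_integral_massRate.add S.continuous_integral_gradientRate
  have hE : ∀ s ∈ Set.Ioi (t - 1), ∫ x, (m s x ^ 2 + n s x ^ 2)
      = (∫ x, (m (t - 1) x ^ 2 + n (t - 1) x ^ 2)) + ∫ τ in (t - 1)..s, ∫ x,
        (massRate lam H u p m τ x + gradientRate lam H H' u p m n τ x) := fun s hs => by
    have h1 := S.integral_m_sq_sub (Set.mem_Ioi.1 hs).le
    have h2 := S.integral_n_sq_sub (Set.mem_Ioi.1 hs).le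
    simp only [integral_add (S.integrable_massRate _) (S.integrable_gradientRate _),
      integral_add (S.integrable_m_sq _) (S.integrable_n_sq _)]
    rw [intervalIntegral.integral_add
      (S.continuous_integral_massRate.intervalIntegrable _ _)
      (S.continuous_integral_gradientRate.intervalIntegrable _ _)]
    linarith
  have h := (intervalIntegral.integral_hasDerivAt_right (hc.intervalIntegrable (t - 1) t)
    (hc.stronglyMeasurableAtFilter _ _) hc.continuousAt).const_add
    (∫ x, (m (t - 1) x ^ 2 + n (t - 1) x ^ 2))
  refine h.congr_of_eventuallyEq ?_
  filter_upwards [Ioi_mem_nhds (show t - 1 < t by linarith)] with s hs using hE s hs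

end IsDecayingSolution

/-- The derivative of `hfun`. -/
noncomputable def hfunDeriv (α β γ Γ : ℝ) (z : ℝ) : ℝ := (α + Γ) + β * z ^ 2 + γ * z ^ 3

/-- The second derivative of `hfun`. -/
noncomputable def hfunSecondDeriv (β γ : ℝ) (z : ℝ) : ℝ := 2 * β * z + 3 * γ * z ^ 2

lemma hasDerivAt_hfun (α β γ Γ z : ℝ) : HasDerivAt (hfun α β γ Γ) (hfunDeriv α β γ Γ z) z := by
  have := (((hasDerivAt_id z).const_mul (α + Γ)).fun_add
    (((hasDerivAt_id z).fun_pow 3).const_mul (β / 3))).fun_add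
    (((hasDerivAt_id z).fun_pow 4).const_mul (γ / 4))
  refine this.congr_deriv ?_
  simp only [hfunDeriv, id]
  push_cast
  ring

lemma hasDerivAt_hfunDeriv (α β γ Γ z : ℝ) :
    HasDerivAt (hfunDeriv α β γ Γ) (hfunSecondDeriv β γ z) z := by
  have := ((((hasDerivAt_id z).fun_pow 2).const_mul β).const_add (α + Γ)).fun_add
    (((hasDerivAt_id z).fun_pow 3).const_mul γ)
  refine this.congr_deriv ?_
  simp only [hfunSecondDeriv, id]
  push_cast
  ring

/-- In the energy identity the term `-4 ∫ u_xx m m_x` equals `2 ∫ u_x m²`. -/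
lemma IsDecayingSolution.integral_rate_eq {lam Γ : ℝ} {H H' : ℝ → ℝ} {u p m n : ℝ → ℝ → ℝ}
    (S : IsDecayingSolution lam Γ H H' u p m n) {t : ℝ} {f f' : ℝ → ℝ}
    (hf : ∀ x, f x = H (u t x) * p t x)
    (hf' : ∀ x, f' x = H' (u t x) * p t x * p t x + H (u t x) * (u t x - m t x))
    (h1 : Integrable fun x => p t x * m t x ^ 2) (h2 : Integrable fun x => p t x * n t x ^ 2)
    (h4 : Integrable fun x => m t x * f x) (h5 : Integrable fun x => n t x * f' x) :
    ∫ x, (massRate lam H u p m t x + gradientRate lam H H' u p m n t x)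
      = -(∫ x, p t x * m t x ^ 2) - 5 * (∫ x, p t x * n t x ^ 2)
        - 2 * lam * (∫ x, (m t x ^ 2 + n t x ^ 2))
        + 2 * ((∫ x, m t x * f x) + ∫ x, n t x * f' x) := by
  have h3 := S.integrable_energy t
  have h1' : Integrable fun x => -(p t x * m t x ^ 2) := h1.neg
  have i1 : Integrable fun x => -(p t x * m t x ^ 2) - 5 * (p t x * n t x ^ 2) :=
    h1'.sub (h2.const_mul 5)
  have i2 : Integrable fun x => -(p t x * m t x ^ 2) - 5 * (p t x * n t x ^ 2)
      - 2 * lam * (m t x ^ 2 + n t x ^ 2) := i1.sub (h3.const_mul (2 * lam))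
  have i3 : Integrable fun x => 2 * (m t x * f x + n t x * f' x) := (h4.add h5).const_mul 2
  have i4 := (S.integrable_massRate t).add (S.integrable_gradientRate t)
  have hd : ∀ x, HasDerivAt (fun y => -2 * (u t y * m t y ^ 2) + 4 / 3 * m t y ^ 3)
      ((massRate lam H u p m t x + gradientRate lam H H' u p m n t x)
        - (-(p t x * m t x ^ 2) - 5 * (p t x * n t x ^ 2) - 2 * lam * (m t x ^ 2 + n t x ^ 2)
          + 2 * (m t x * f x + n t x * f' x))) x := fun x => by
    refine ((((S.hasDerivAt_u t x).fun_mul ((S.hasDerivAt_m t x).fun_pow 2)).const_mul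
      (-2)).fun_add (((S.hasDerivAt_m t x).fun_pow 3).const_mul (4 / 3))).congr_deriv ?_
    rw [hf, hf']
    unfold massRate gradientRate forcing forcingDeriv
    push_cast
    ring
  have h_bot : Tendsto (fun y => -2 * (u t y * m t y ^ 2) + 4 / 3 * m t y ^ 3) atBot
      (nhds 0) := by
    have h := (((S.u_atBot t).mul ((S.m_atBot t).pow 2)).const_mul (-2)).add
      (((S.m_atBot t).pow 3).const_mul (4 / 3))
    convert h using 2
    norm_num
  have h_top : Tendsto (fun y => -2 * (u t y * m t y ^ 2) + 4 / 3 * m t y ^ 3) atTop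
      (nhds 0) := by
    have h := (((S.u_atTop t).mul ((S.m_atTop t).pow 2)).const_mul (-2)).add
      (((S.m_atTop t).pow 3).const_mul (4 / 3))
    convert h using 2
    norm_num
  have hz := integral_of_hasDerivAt_of_tendsto hd (i4.sub (i2.add i3)) h_bot h_top
  have hs := integral_sub i4 (i2.add i3)
  simp only [Pi.add_apply] at hs
  rw [hs, integral_add i2 i3, integral_sub i1 (h3.const_mul (2 * lam)),
    integral_sub h1' (h2.const_mul 5), integral_neg, integral_const_mul, integral_const_mul,
    integral_const_mul, integral_add h4 h5] at hz
  linarith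

/-- identity (4.0.10) of the paper:
`d/dt ∫ (m² + m_x²) = -∫ u_x m² - 5∫ u_x m_x² - 2λ∫(m² + m_x²)
  + 2(∫ m ∂_x(h∘u) + ∫ m_x ∂_x²(h∘u))`. -/
theorem stmt_15 (lam α β γ Γ : ℝ) (u : ℝ → ℝ → ℝ)
    (hreg : ∀ t : ℝ, ContDiff ℝ 3 (u t))
    (heq : ∀ t x : ℝ,
      deriv (fun s => mfun u s x) t
        = -(u t x + Γ) * deriv (mfun u t) x - 2 * deriv (u t) x * mfun u t x
          - lam * mfun u t x + deriv (fun y => hfun α β γ Γ (u t y)) x)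
    (hmt : ∀ t x : ℝ, DifferentiableAt ℝ (fun s => mfun u s x) t)
    (hmtx : ∀ t x : ℝ, DifferentiableAt ℝ (fun s => deriv (mfun u s) x) t)
    (hcomm : ∀ t x : ℝ,
      deriv (fun s => deriv (mfun u s) x) t
        = deriv (fun y => deriv (fun s => mfun u s y) t) x)
    (huTop : ∀ t : ℝ, Tendsto (u t) atTop (nhds 0))
    (huBot : ∀ t : ℝ, Tendsto (u t) atBot (nhds 0))
    (huxTop : ∀ t : ℝ, Tendsto (deriv (u t)) atTop (nhds 0))
    (huxBot : ∀ t : ℝ, Tendsto (deriv (u t)) atBot (nhds 0))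
    (hmTop : ∀ t : ℝ, Tendsto (mfun u t) atTop (nhds 0))
    (hmBot : ∀ t : ℝ, Tendsto (mfun u t) atBot (nhds 0))
    (hmxTop : ∀ t : ℝ, Tendsto (deriv (mfun u t)) atTop (nhds 0))
    (hmxBot : ∀ t : ℝ, Tendsto (deriv (mfun u t)) atBot (nhds 0))
    (hi1 : ∀ t : ℝ, Integrable (fun x => deriv (u t) x * (mfun u t x) ^ 2))
    (hi2 : ∀ t : ℝ, Integrable (fun x => deriv (u t) x * (deriv (mfun u t) x) ^ 2))
    (hi3 : ∀ t : ℝ, Integrable (fun x => (mfun u t x) ^ 2 + (deriv (mfun u t) x) ^ 2))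
    (hi4 : ∀ t : ℝ, Integrable (fun x => mfun u t x * deriv (fun y => hfun α β γ Γ (u t y)) x))
    (hi5 : ∀ t : ℝ, Integrable (fun x =>
      deriv (mfun u t) x * deriv (deriv (fun y => hfun α β γ Γ (u t y))) x))
    (hi6 : ∀ t : ℝ, Integrable (fun x =>
      deriv (fun s => ((mfun u s x) ^ 2 + (deriv (mfun u s) x) ^ 2)) t))
    (hdiff : ∀ t : ℝ,
      HasDerivAt (fun s => ∫ x : ℝ, ((mfun u s x) ^ 2 + (deriv (mfun u s) x) ^ 2))
        (∫ x : ℝ, deriv (fun s => ((mfun u s x) ^ 2 + (deriv (mfun u s) x) ^ 2)) t) t) :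
    ∀ t : ℝ,
      HasDerivAt (fun s => ∫ x : ℝ, ((mfun u s x) ^ 2 + (deriv (mfun u s) x) ^ 2))
        (-(∫ x : ℝ, deriv (u t) x * (mfun u t x) ^ 2)
          - 5 * (∫ x : ℝ, deriv (u t) x * (deriv (mfun u t) x) ^ 2)
          - 2 * lam * (∫ x : ℝ, ((mfun u t x) ^ 2 + (deriv (mfun u t) x) ^ 2))
          + 2 * ((∫ x : ℝ, mfun u t x * deriv (fun y => hfun α β γ Γ (u t y)) x)
            + ∫ x : ℝ, deriv (mfun u t) x * deriv (deriv (fun y => hfun α β γ Γ (u t y))) x)) t := by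
  have hu2 : ∀ t, ContDiff ℝ 2 (deriv (u t)) := fun t =>
    ((contDiff_succ_iff_deriv (n := 2)).1 (hreg t)).2.2
  have hu1 : ∀ t, ContDiff ℝ 1 (deriv (deriv (u t))) := fun t =>
    ((contDiff_succ_iff_deriv (n := 1)).1 (hu2 t)).2.2
  have hm1 : ∀ t, ContDiff ℝ 1 (mfun u t) := fun t => ((hreg t).of_le (by norm_num)).sub (hu1 t)
  have du : ∀ t x, HasDerivAt (u t) (deriv (u t) x) x := fun t x =>
    ((hreg t).differentiable (by norm_num) x).hasDerivAt
  have dp : ∀ t x, HasDerivAt (deriv (u t)) (u t x - mfun u t x) x := fun t x =>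
    ((hu2 t).differentiable (by norm_num) x).hasDerivAt.congr_deriv (by simp [mfun])
  have hf : ∀ t x, deriv (fun y => hfun α β γ Γ (u t y)) x
      = hfunDeriv α β γ Γ (u t x) * deriv (u t) x := fun t x =>
    ((hasDerivAt_hfun α β γ Γ (u t x)).comp x (du t x)).deriv
  have hf' : ∀ t x, deriv (deriv (fun y => hfun α β γ Γ (u t y))) x
      = hfunSecondDeriv β γ (u t x) * deriv (u t) x * deriv (u t) x
        + hfunDeriv α β γ Γ (u t x) * (u t x - mfun u t x) := fun t x => by
    rw [funext (hf t)]
    exact (((hasDerivAt_hfunDeriv α β γ Γ (u t x)).comp x (du t x)).fun_mul (dp t x)).deriv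
  have S : IsDecayingSolution lam Γ (hfunDeriv α β γ Γ) (hfunSecondDeriv β γ) u
      (fun t => deriv (u t)) (mfun u) (fun t => deriv (mfun u t)) :=
    { hasDerivAt_H := hasDerivAt_hfunDeriv α β γ Γ
      continuous_H' := by unfold hfunSecondDeriv; fun_prop
      hasDerivAt_u := du
      hasDerivAt_p := dp
      hasDerivAt_m := fun t x => ((hm1 t).differentiable (by norm_num) x).hasDerivAt
      continuous_n := fun t => (hm1 t).continuous_deriv le_rfl
      u_atBot := huBot
      u_atTop := huTop
      p_atBot := huxBot
      p_atTop := huxTop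
      m_atBot := hmBot
      m_atTop := hmTop
      evolution := fun t x => (hmt t x).hasDerivAt.congr_deriv (by rw [heq, hf]; ring)
      continuous_n_time := fun x => continuous_iff_continuousAt.2 fun t => (hmtx t x).continuousAt
      integrable_energy := hi3
      continuous_energy := continuous_iff_continuousAt.2 fun t => (hdiff t).continuousAt }
  intro t
  exact (S.hasDerivAt_energy t).congr_deriv
    (S.integral_rate_eq (hf t) (hf' t) (hi1 t) (hi2 t) (hi4 t) (hi5 t))
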